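/- arXiv:cs/0201001 — 2 statements merged into one kernel-verified Lean document; each statement's English description precedes it below -/
import Mathlib

section
/- For every prime p there exists a constant C > 0 (which may depend on p) such that for every n ≥ 1, every bilinear computation of n×n matrix product over GF(p) has length m ≥ (5/2 + 3/(2(p³−1)))·n² − C·n^(7/4). Equivalently, the bilinear rank of n×n matrix product over GF(p) is at least (2.5 + 1.5/(p³−1))·n² − O(n^(7/4)). -/
open Matrix Finset

/-- A polynomial that does not vanish at some point does not vanish at some point whose support
has at most as many elements as the total degree. -/
theorem MvPolynomial.exists_eval_ne_zero_card_support_le {σ F : Type*} [Fintype σ] [DecidableEq σ]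
    [Field F] [DecidableEq F] (P : MvPolynomial σ F) (hP : ∃ x, eval x P ≠ 0) :
    ∃ x, eval x P ≠ 0 ∧ #{i | x i ≠ 0} ≤ P.totalDegree := by
  classical
  obtain ⟨x, hx, hmin⟩ : ∃ x, eval x P ≠ 0 ∧
      ∀ y, eval y P ≠ 0 → #{i | x i ≠ 0} ≤ #{i | y i ≠ 0} := by
    obtain ⟨x, hx, h⟩ := (measure fun x : σ → F => #{i | x i ≠ 0}).wf.has_min
      {x | eval x P ≠ 0} hP
    exact ⟨x, hx, fun y hy => not_lt.1 (h y hy)⟩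
  refine ⟨x, hx, ?_⟩
  by_contra! hlt
  set S : Finset σ := {i | x i ≠ 0} with hS
  let r (T : Finset σ) (i : σ) : F := if i ∈ T then x i else 0
  have hsum : ∑ T ∈ S.powerset, (-1 : F) ^ #T * eval (r T) P = 0 := by
    simp only [eval_eq, mul_sum]
    rw [sum_comm]
    refine sum_eq_zero fun d hd => ?_
    obtain ⟨i, hiS, hid⟩ : ∃ i ∈ S, i ∉ d.support := by
      by_contra! h
      have h₁ := card_le_card (show S ⊆ d.support from h)
      have h₂ : #d.support ≤ d.sum fun _ e => e := by
        rw [card_eq_sum_ones]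
        exact sum_le_sum fun j hj => Nat.one_le_iff_ne_zero.2 (Finsupp.mem_support_iff.1 hj)
      have := le_totalDegree hd
      omega
    rw [← insert_erase hiS, sum_powerset_insert (notMem_erase i S), ← sum_add_distrib]
    refine sum_eq_zero fun T hT => ?_
    have hiT : i ∉ T := fun h => notMem_erase i S (mem_powerset.1 hT h)
    have hprod : ∏ j ∈ d.support, r (insert i T) j ^ d j = ∏ j ∈ d.support, r T j ^ d j := by
      refine prod_congr rfl fun j hj => ?_
      have : j ≠ i := fun h => hid (h ▸ hj)
      simp [r, this]
    rw [hprod, card_insert_of_notMem hiT]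
    ring
  have hrS : r S = x := by
    ext i
    by_cases hi : x i = 0 <;> simp [r, hS, hi]
  rw [sum_eq_single S, hrS] at hsum
  · simp [hx] at hsum
  · intro T hT hTS
    have hTss : T ⊂ S := (mem_powerset.1 hT).ssubset_of_ne hTS
    by_contra hne
    have h := hmin (r T) (right_ne_zero_of_mul hne)
    have hsub : ({i | r T i ≠ 0} : Finset σ) ⊆ T := by
      intro i hi
      by_contra hiT
      simp [r, hiT] at hi
    exact absurd (card_lt_card hTss) (not_lt.2 (h.trans (card_le_card hsub)))
  · simp

/-- The determinant of a matrix of polynomials of total degree at most one. -/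
theorem Matrix.totalDegree_det_le {σ ι R : Type*} [Fintype ι] [DecidableEq ι] [CommRing R]
    (M : Matrix ι ι (MvPolynomial σ R)) (hM : ∀ i j, (M i j).totalDegree ≤ 1) :
    M.det.totalDegree ≤ Fintype.card ι := by
  rw [det_apply]
  refine MvPolynomial.totalDegree_finsetSum_le fun s _ => ?_
  have h : (∏ i, M (s i) i).totalDegree ≤ Fintype.card ι := by
    refine (MvPolynomial.totalDegree_finsetProd _ _).trans ?_
    refine (sum_le_sum fun i _ => hM (s i) i).trans ?_
    simp
  rcases Int.units_eq_one_or (Equiv.Perm.sign s) with hs | hs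
  · simpa [hs] using h
  · simpa [hs] using h

namespace Matrix

variable {R S ι κ : Type*} [CommRing R] [CommRing S]

/-- The Koszul matrix of three square matrices. -/
def koszul (A B C : Matrix ι ι R) : Matrix (Fin 3 × ι) (Fin 3 × ι) R :=
  comp (Fin 3) (Fin 3) ι ι R !![A, 0, C; 0, A, B; B, -C, 0]

theorem koszul_apply (A B C : Matrix ι ι R) (i j : Fin 3) (a b : ι) :
    koszul A B C (i, a) (j, b) =
      !![A a b, 0, C a b; 0, A a b, B a b; B a b, -C a b, 0] i j := by
  fin_cases i <;> fin_cases j <;> rfl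

theorem koszul_map (f : R →+* S) (A B C : Matrix ι ι R) :
    (koszul A B C).map f = koszul (A.map f) (B.map f) (C.map f) := by
  ext ⟨i, a⟩ ⟨j, b⟩
  fin_cases i <;> fin_cases j <;> simp [koszul_apply]

theorem koszul_totalDegree_le {σ : Type*} {A B C : Matrix ι ι (MvPolynomial σ R)}
    (hA : ∀ i j, (A i j).totalDegree ≤ 1) (hB : ∀ i j, (B i j).totalDegree ≤ 1)
    (hC : ∀ i j, (C i j).totalDegree ≤ 1) (x y : Fin 3 × ι) :
    (koszul A B C x y).totalDegree ≤ 1 := by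
  obtain ⟨i, a⟩ := x
  obtain ⟨j, b⟩ := y
  fin_cases i <;> fin_cases j <;> simp [koszul_apply, hA, hB, hC]

/-- The `2 × 2` matrices attached to the vectors of a space of dimension three. -/
def pencil (a : Fin 3 → R) : Matrix (Fin 2) (Fin 2) R := !![a 0, a 1; a 2, a 0]

set_option maxHeartbeats 4000000 in
theorem det_koszul_pencil_aux (a₀ a₁ a₂ b₀ b₁ b₂ c₀ c₁ c₂ : R) :
    det !![a₀, a₁, 0, 0, c₀, c₁;
      a₂, a₀, 0, 0, c₂, c₀;
      0, 0, a₀, a₁, b₀, b₁;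
      0, 0, a₂, a₀, b₂, b₀;
      b₀, b₁, -c₀, -c₁, 0, 0;
      b₂, b₀, -c₂, -c₀, 0, 0] = -det !![a₀, a₁, a₂; b₀, b₁, b₂; c₀, c₁, c₂] ^ 2 := by
  simp [det_succ_row_zero, Fin.sum_univ_succ, Fin.succAbove]
  ring

theorem det_koszul_pencil (V : Matrix (Fin 3) (Fin 3) R) :
    (koszul (pencil (V 0)) (pencil (V 1)) (pencil (V 2))).det = -V.det ^ 2 := by
  rw [← det_reindex_self finProdFinEquiv, eta_fin_three V, ← det_koszul_pencil_aux]
  congr 1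
  ext i j
  fin_cases i <;> fin_cases j <;> rfl

/-- Expanding the entries of three matrices along a ring homomorphism into matrices preserves
invertibility of the Koszul matrix. -/
theorem isUnit_koszul_comp [Fintype ι] [DecidableEq ι] [Fintype κ] [DecidableEq κ]
    (f : S →+* Matrix κ κ R) {A B C : Matrix ι ι S} (h : IsUnit (koszul A B C)) :
    IsUnit (koszul (comp ι ι κ κ R (A.map f)) (comp ι ι κ κ R (B.map f))
      (comp ι ι κ κ R (C.map f))) := by
  have h₁ := (h.map f.mapMatrix).map (compRingEquiv (Fin 3 × ι) κ R)
  have h₂ := h₁.map (reindexRingEquiv R (Equiv.prodAssoc (Fin 3) ι κ))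
  convert h₂ using 1
  ext ⟨i, a, c⟩ ⟨j, b, d⟩
  fin_cases i <;> fin_cases j <;> simp [koszul_apply]

/-- If the Koszul matrix of three matrices is invertible, then a bilinear computation of the matrix
product has many forms that do not vanish on all three of them. -/
theorem three_mul_card_sq_le_of_isUnit_koszul {F ι κ : Type*} [Field F] [Fintype ι] [DecidableEq ι]
    [Fintype κ] {μ η : κ → Matrix ι ι F →ₗ[F] F} {α : κ → ι → ι → F}
    (hμ : ∀ x y i j, (x * y) i j = ∑ k, α k i j * μ k x * η k y)
    {A B C : Matrix ι ι F} (h : IsUnit (koszul A B C)) (s : Finset κ)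
    (hs : ∀ k ∉ s, μ k A = 0 ∧ μ k B = 0 ∧ μ k C = 0) :
    3 * Fintype.card ι ^ 2 ≤ 2 * #s := by
  classical
  let φ (k : κ) : (Fin 3 → F) →ₗ[F] F :=
    μ k B • LinearMap.proj 0 - μ k C • LinearMap.proj 1 - μ k A • LinearMap.proj 2
  let t : Finset κ := {k | ¬ (μ k A = 0 ∧ μ k B = 0 ∧ μ k C = 0)}
  have hts : t ⊆ s := fun k hk => by
    by_contra hks
    exact (mem_filter.1 hk).2 (hs k hks)
  have hφ (k : t) : Module.finrank F (LinearMap.ker (φ k)) = 2 := by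
    have hne : φ k ≠ 0 := fun h0 => by
      apply (mem_filter.1 k.2).2
      have h₁ := LinearMap.congr_fun h0 (Pi.single 0 1)
      have h₂ := LinearMap.congr_fun h0 (Pi.single 1 1)
      have h₃ := LinearMap.congr_fun h0 (Pi.single 2 1)
      simp [φ] at h₁ h₂ h₃
      exact ⟨h₃, h₁, h₂⟩
    have := Module.Dual.finrank_ker_add_one_of_ne_zero (f := φ k) hne
    simpa using this
  let Ψ : ((k : t) → LinearMap.ker (φ k)) →ₗ[F] Matrix (Fin 3 × ι) ι F :=
    { toFun := fun w => of fun x b => ∑ k : t, α k x.2 b * (w k : Fin 3 → F) x.1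
      map_add' := fun v w => by
        ext x b
        simp [mul_add, sum_add_distrib]
      map_smul' := fun c w => by
        ext x b
        simp [mul_sum, mul_left_comm] }
  have hΨ : Function.Surjective Ψ := by
    intro Z
    obtain ⟨N, hN⟩ := h.exists_right_inv
    let Y (i : Fin 3) : Matrix ι ι F := of fun a b => (N * Z) (i, a) b
    let w (k : κ) : Fin 3 → F :=
      ![μ k A * η k (Y 0) + μ k C * η k (Y 2), μ k A * η k (Y 1) + μ k B * η k (Y 2),
        μ k B * η k (Y 0) - μ k C * η k (Y 1)]
    have hw (k : κ) : w k ∈ LinearMap.ker (φ k) := by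
      simp [φ, w]
      ring
    refine ⟨fun k => ⟨w k, hw k⟩, ?_⟩
    have hZ : Z = koszul A B C * (N * Z) := by rw [← Matrix.mul_assoc, hN, Matrix.one_mul]
    have hY (M : Matrix ι ι F) (i : Fin 3) (a b : ι) :
        ∑ c, M a c * (N * Z) (i, c) b = ∑ k, α k a b * μ k M * η k (Y i) := by
      rw [← hμ, mul_apply]
      rfl
    have hsub (x : Fin 3 × ι) (b : ι) :
        ∑ k : t, α k x.2 b * w k x.1 = ∑ k, α k x.2 b * w k x.1 := by
      rw [sum_coe_sort t fun k => α k x.2 b * w k x.1]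
      refine sum_subset (subset_univ _) fun k _ hk => ?_
      have : μ k A = 0 ∧ μ k B = 0 ∧ μ k C = 0 := by simpa [t] using hk
      obtain ⟨i, a⟩ := x
      fin_cases i <;> simp [w, this]
    conv_rhs => rw [hZ]
    ext ⟨i, a⟩ b
    change ∑ k : t, α k a b * w k i = _
    rw [hsub (i, a) b, mul_apply, Fintype.sum_prod_type, Fin.sum_univ_three]
    fin_cases i <;>
      simp [koszul_apply, hY, w, mul_add, sum_add_distrib, mul_assoc,
        sub_eq_add_neg]
  have hrank := LinearMap.finrank_le_finrank_of_surjective hΨ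
  rw [Module.finrank_pi_fintype, sum_congr rfl fun k _ => hφ k, Module.finrank_matrix] at hrank
  simp at hrank
  have := card_le_card hts
  nlinarith

section Moore

variable {p : ℕ} [Fact p.Prime] {E ι : Type*} [Field E] [Algebra (ZMod p) E] [Fintype ι]

theorem sum_zmod_smul_pow (g : ι → ZMod p) (v : ι → E) (j : ℕ) :
    (∑ i, g i • v i) ^ p ^ j = ∑ i, g i • v i ^ p ^ j := by
  have : CharP E p := charP_of_injective_algebraMap (algebraMap (ZMod p) E).injective p
  rw [sum_pow_char_pow]
  simp [smul_pow, ZMod.pow_card_pow]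

/-- The Moore determinant of linearly independent elements does not vanish. -/
theorem det_moore_ne_zero {n : ℕ} {v : Fin n → E} (hv : LinearIndependent (ZMod p) v) :
    (of fun i j : Fin n => v i ^ p ^ (j : ℕ)).det ≠ 0 := by
  classical
  intro hdet
  obtain ⟨c, hc, hMc⟩ := exists_mulVec_eq_zero_iff.2 hdet
  have hp := (Fact.out : p.Prime)
  let P : Polynomial E := ∑ j : Fin n, Polynomial.monomial (p ^ (j : ℕ)) (c j)
  obtain ⟨j₀, hj₀⟩ := Function.ne_iff.1 hc
  have hP : P ≠ 0 := by
    intro h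
    apply hj₀
    have h₁ := congr_arg (fun Q => Polynomial.coeff Q (p ^ (j₀ : ℕ))) h
    simp only [P, Polynomial.finsetSum_coeff, Polynomial.coeff_monomial,
      Polynomial.coeff_zero] at h₁
    rw [sum_eq_single j₀] at h₁
    · simpa using h₁
    · intro j _ hj
      rw [if_neg]
      exact fun h => hj (Fin.ext (Nat.pow_right_injective hp.two_le h))
    · simp
  have hdeg : P.natDegree < p ^ n := by
    have hn : n ≠ 0 := fun h => (h ▸ j₀).elim0
    refine lt_of_le_of_lt (b := p ^ (n - 1)) ?_ (Nat.pow_lt_pow_right hp.one_lt (by omega))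
    refine Polynomial.natDegree_sum_le_of_forall_le _ _ fun j _ => ?_
    exact (Polynomial.natDegree_monomial_le _).trans
      (Nat.pow_le_pow_right hp.pos (by omega))
  let f : (Fin n → ZMod p) → E := fun g => ∑ i, g i • v i
  have hf : Function.Injective f := by
    intro g h hgh
    have h₁ := Fintype.linearIndependent_iff.1 hv (g - h) (by
      simpa [sub_smul, sum_sub_distrib, sub_eq_zero] using hgh)
    ext1 i
    exact sub_eq_zero.1 (h₁ i)
  have hroot (g : Fin n → ZMod p) : P.eval (f g) = 0 := by
    simp only [P, Polynomial.eval_finsetSum, Polynomial.eval_monomial, f, sum_zmod_smul_pow,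
      mul_sum]
    rw [sum_comm]
    refine sum_eq_zero fun i _ => ?_
    have h := congr_fun hMc i
    simp only [mulVec, dotProduct, of_apply, Pi.zero_apply] at h
    rw [← smul_zero (g i), ← h, smul_sum]
    refine sum_congr rfl fun j _ => ?_
    rw [mul_smul_comm, mul_comm]
  have hcard := Polynomial.card_le_degree_of_subset_roots (p := P)
    (Z := univ.map ⟨f, hf⟩) (by
      intro x hx
      simp only [mem_val, mem_map, mem_univ, true_and, Function.Embedding.coeFn_mk] at hx
      obtain ⟨g, rfl⟩ := hx
      exact (Polynomial.mem_roots hP).2 (hroot g))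
  simp [ZMod.card] at hcard
  omega

/-- There is a space of matrices in which the Koszul matrices of all linearly independent triples
are invertible. -/
theorem exists_isUnit_koszul {k e : ℕ} (he : e ≠ 0) (hk : k ≤ e) :
    ∃ A : Fin k → Matrix (Fin 2 × Fin e) (Fin 2 × Fin e) (ZMod p),
      ∀ v : Fin 3 → Fin k → ZMod p, LinearIndependent (ZMod p) v →
        IsUnit (koszul (∑ i, v 0 i • A i) (∑ i, v 1 i • A i) (∑ i, v 2 i • A i)) := by
  let E := GaloisField p e
  let b : Module.Basis (Fin e) (ZMod p) E := Module.finBasisOfFinrankEq _ _ (GaloisField.finrank p he)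
  let f : E →+* Matrix (Fin e) (Fin e) (ZMod p) := (Algebra.leftMulMatrix b).toRingHom
  have hf (c : ZMod p) (x : E) : f (c • x) = c • f x := map_smul (Algebra.leftMulMatrix b) c x
  let β (i : Fin k) : E := b (Fin.castLE hk i)
  let w (x : E) (j : Fin 3) : E := x ^ p ^ (j : ℕ)
  let A (x : E) : Matrix (Fin 2 × Fin e) (Fin 2 × Fin e) (ZMod p) :=
    comp _ _ _ _ _ ((pencil (w x)).map f)
  have hw (g : Fin k → ZMod p) (j : Fin 3) :
      f (w (∑ i, g i • β i) j) = ∑ i, g i • f (w (β i) j) := by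
    simp only [w, sum_zmod_smul_pow, map_sum, hf]
  have hA (g : Fin k → ZMod p) : ∑ i, g i • A (β i) = A (∑ i, g i • β i) := by
    ext ⟨i, c⟩ ⟨j, d⟩
    fin_cases i <;> fin_cases j <;> simp [A, pencil, hw, Matrix.sum_apply]
  refine ⟨fun i => A (β i), fun v hv => ?_⟩
  simp only [hA]
  apply isUnit_koszul_comp f
  let V : Matrix (Fin 3) (Fin 3) E := of fun i => w (∑ l, v i l • β l)
  rw [isUnit_iff_isUnit_det]
  have hdet := det_koszul_pencil V
  change (koszul (pencil (w _)) (pencil (w _)) (pencil (w _))).det = _ at hdet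
  rw [hdet, isUnit_iff_ne_zero, neg_ne_zero]
  refine pow_ne_zero 2 (det_moore_ne_zero ?_)
  have hβ : LinearIndependent (ZMod p) β := b.linearIndependent.comp _ (Fin.castLE_injective hk)
  have h := hv.map' (Fintype.linearCombination (ZMod p) β)
    (LinearMap.ker_eq_bot'.2 fun g hg => funext (Fintype.linearIndependent_iff.1 hβ g hg))
  exact h

end Moore

/-- If some family of matrices has invertible Koszul matrices at all triples of a finite set, then
such a family can be found on which most elements of a basis among given linear forms vanish. -/
theorem exists_isUnit_koszul_of_forms {F ι κ τ : Type*} [Field F] [DecidableEq F] [Fintype ι]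
    [DecidableEq ι] [Fintype κ] [DecidableEq κ] [Fintype τ] [DecidableEq τ]
    {μ : κ → Matrix ι ι F →ₗ[F] F} (hμ : ∀ x, (∀ k, μ k x = 0) → x = 0)
    (s : Finset (Fin 3 → τ → F))
    (hs : ∃ A : τ → Matrix ι ι F, ∀ v ∈ s,
      IsUnit (koszul (∑ i, v 0 i • A i) (∑ i, v 1 i • A i) (∑ i, v 2 i • A i))) :
    ∃ (J S : Finset κ) (A : τ → Matrix ι ι F), #J = Fintype.card ι ^ 2 ∧
      #S ≤ #s * (3 * Fintype.card ι) ∧ (∀ j ∈ J, j ∉ S → ∀ i, μ j (A i) = 0) ∧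
      ∀ v ∈ s, IsUnit (koszul (∑ i, v 0 i • A i) (∑ i, v 1 i • A i) (∑ i, v 2 i • A i)) := by
  classical
  obtain ⟨κ', a, ha, hspan, hli⟩ := exists_linearIndependent' F μ
  have : Fintype κ' := Fintype.ofInjective a ha
  let Φ : Matrix ι ι F →ₗ[F] κ' → F := LinearMap.pi fun j => μ (a j)
  have hΦ : Function.Injective Φ := by
    rw [← LinearMap.ker_eq_bot, LinearMap.ker_eq_bot']
    intro x hx
    refine hμ x fun k => ?_
    have hk : μ k ∈ Submodule.span F (Set.range (μ ∘ a)) :=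
      hspan ▸ Submodule.subset_span (Set.mem_range_self k)
    have hle : Submodule.span F (Set.range (μ ∘ a)) ≤
        LinearMap.ker (Module.Dual.eval F (Matrix ι ι F) x) := by
      rw [Submodule.span_le]
      rintro _ ⟨j, rfl⟩
      exact congr_fun hx j
    exact hle hk
  have hcard : Fintype.card κ' = Fintype.card ι ^ 2 := by
    apply le_antisymm
    · have h := hli.fintype_card_le_finrank
      rw [Subspace.dual_finrank_eq, Module.finrank_matrix] at h
      simpa [sq] using h
    · have h := LinearMap.finrank_le_finrank_of_injective hΦ
      rw [Module.finrank_matrix] at h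
      simpa [sq] using h
  let Φe : Matrix ι ι F ≃ₗ[F] κ' → F := LinearEquiv.ofInjectiveOfFinrankEq Φ hΦ (by
    rw [Module.finrank_matrix]
    simp [hcard, sq])
  have hΦe (x : Matrix ι ι F) (j : κ') : Φe x j = μ (a j) x := rfl
  let M (x : τ × κ' → F) (i : τ) : Matrix ι ι F := Φe.symm fun j => x (i, j)
  let G (g : τ → F) : Matrix ι ι (MvPolynomial (τ × κ') F) := of fun b c =>
    ∑ i, ∑ j, MvPolynomial.C (g i * Φe.symm (Pi.single j 1) b c) * MvPolynomial.X (i, j)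
  have hGdeg (g : τ → F) (b c : ι) : (G g b c).totalDegree ≤ 1 := by
    refine MvPolynomial.totalDegree_finsetSum_le fun i _ =>
      MvPolynomial.totalDegree_finsetSum_le fun j _ => ?_
    refine (MvPolynomial.totalDegree_mul _ _).trans ?_
    rw [MvPolynomial.totalDegree_C, MvPolynomial.totalDegree_X]
  have hGeval (x : τ × κ' → F) (g : τ → F) :
      (G g).map (MvPolynomial.eval x) = ∑ i, g i • M x i := by
    ext b c
    simp only [G, map_apply, of_apply, map_sum, map_mul, MvPolynomial.eval_C, MvPolynomial.eval_X,
      Matrix.sum_apply, smul_apply, smul_eq_mul]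
    refine sum_congr rfl fun i _ => ?_
    have h : M x i = ∑ j, x (i, j) • Φe.symm (Pi.single j 1) := by
      simp only [M, ← map_smul, ← map_sum]
      congr 1
      ext j
      simp [Finset.sum_apply, Pi.single_apply]
    rw [h, Matrix.sum_apply, mul_sum]
    refine sum_congr rfl fun j _ => ?_
    simp only [smul_apply, smul_eq_mul]
    ring
  let P : MvPolynomial (τ × κ') F := ∏ v ∈ s, (koszul (G (v 0)) (G (v 1)) (G (v 2))).det
  have hPdeg : P.totalDegree ≤ #s * (3 * Fintype.card ι) := by
    refine (MvPolynomial.totalDegree_finsetProd _ _).trans ?_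
    rw [← smul_eq_mul]
    refine sum_le_card_nsmul _ _ _ fun v _ => ?_
    refine (totalDegree_det_le _ (koszul_totalDegree_le (hGdeg _) (hGdeg _) (hGdeg _))).trans ?_
    simp
  have hPeval (x : τ × κ' → F) : MvPolynomial.eval x P ≠ 0 ↔ ∀ v ∈ s,
      IsUnit (koszul (∑ i, v 0 i • M x i) (∑ i, v 1 i • M x i) (∑ i, v 2 i • M x i)) := by
    simp only [P, map_prod, prod_ne_zero_iff, RingHom.map_det, RingHom.mapMatrix_apply, koszul_map,
      hGeval, isUnit_iff_isUnit_det, isUnit_iff_ne_zero]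
  obtain ⟨A, hA⟩ := hs
  have hM : M (fun ij => Φe (A ij.1) ij.2) = A := by
    ext1 i
    exact Φe.symm_apply_apply (A i)
  obtain ⟨x, hx, hxcard⟩ := P.exists_eval_ne_zero_card_support_le
    ⟨fun ij => Φe (A ij.1) ij.2, (hPeval _).2 (by rwa [hM])⟩
  refine ⟨univ.map ⟨a, ha⟩, ({ij | x ij ≠ 0} : Finset (τ × κ')).image fun ij => a ij.2, M x, ?_,
    card_image_le.trans (hxcard.trans hPdeg), ?_, (hPeval x).1 hx⟩
  · simp [hcard]
  · intro j hj hjS i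
    obtain ⟨j, -, rfl⟩ := mem_map.1 hj
    have h₀ : x (i, j) = 0 := by
      by_contra h
      exact hjS (mem_image.2 ⟨(i, j), by simpa using h, rfl⟩)
    have h₁ : Φe (M x i) j = x (i, j) := by simp [M]
    exact h₁.trans h₀

/-- A linear form on a vector space over `ZMod p` vanishes at a proportion of at least `p⁻³` of the
triples of vectors. -/
theorem card_le_mul_card_triples_zero {p : ℕ} [Fact p.Prime] {V : Type*} [AddCommGroup V]
    [Module (ZMod p) V] [Fintype V] [DecidableEq V] (l : V →ₗ[ZMod p] ZMod p) :
    Fintype.card V ^ 3 ≤ #{v : Fin 3 → V | ∀ i, l (v i) = 0} * p ^ 3 := by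
  let L : (Fin 3 → V) →+ (Fin 3 → ZMod p) :=
    (LinearMap.pi fun i => l ∘ₗ LinearMap.proj i : (Fin 3 → V) →ₗ[ZMod p] _).toAddMonoidHom
  have hL (v : Fin 3 → V) : L v = fun i => l (v i) := rfl
  have h := L.ker.card_mul_index
  rw [AddSubgroup.index_ker] at h
  have h₁ : Nat.card L.range ≤ p ^ 3 := by
    refine (Nat.card_le_card_of_injective _ Subtype.val_injective).trans ?_
    simp
  have h₂ : Nat.card L.ker = #{v : Fin 3 → V | ∀ i, l (v i) = 0} := by
    rw [← Nat.card_eq_finsetCard]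
    refine Nat.card_congr (Equiv.subtypeEquivRight fun v => ?_)
    simp [AddMonoidHom.mem_ker, hL, funext_iff]
  have h₃ : Nat.card (Fin 3 → V) = Fintype.card V ^ 3 := by simp
  rw [← h₃, ← h, h₂]
  exact Nat.mul_le_mul_left _ h₁

theorem card_filter_linearIndependent_ge {p : ℕ} [Fact p.Prime] {k : ℕ} (hk : 3 ≤ k)
    (s : Finset (Fin 3 → Fin k → ZMod p)) (hs : ∀ v, v ∈ s ↔ LinearIndependent (ZMod p) v) :
    ((p : ℝ) ^ k) ^ 3 - (p : ℝ) ^ 3 * ((p : ℝ) ^ k) ^ 2 ≤ #s := by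
  have h := card_linearIndependent (K := ZMod p) (V := Fin k → ZMod p) (k := 3) (by simpa using hk)
  have h₁ : Nat.card {v : Fin 3 → Fin k → ZMod p // LinearIndependent (ZMod p) v} = #s := by
    rw [← Nat.card_eq_finsetCard]
    exact Nat.card_congr (Equiv.subtypeEquivRight fun v => (hs v).symm)
  have hp : 2 ≤ p := (Fact.out : p.Prime).two_le
  have hle (i : ℕ) (hi : i ≤ k) : p ^ i ≤ p ^ k := Nat.pow_le_pow_right (by omega) hi
  rw [h₁] at h
  simp only [Module.finrank_fintype_fun_eq_card, Fintype.card_fin, ZMod.card, Fin.prod_univ_three,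
    Fin.val_zero, Fin.val_one, Fin.val_two] at h
  have h₂ : ((#s : ℕ) : ℝ) = ((p : ℝ) ^ k - 1) * ((p : ℝ) ^ k - p) * ((p : ℝ) ^ k - p ^ 2) := by
    rw [h]
    push_cast [hle 0 (by omega), hle 1 (by omega), hle 2 (by omega)]
    ring
  rw [h₂]
  have hpR : (2 : ℝ) ≤ p := by exact_mod_cast hp
  have hq : (p : ℝ) ^ 3 ≤ (p : ℝ) ^ k := pow_le_pow_right₀ (by linarith) hk
  generalize (p : ℝ) ^ k = q at *
  have hq₀ : 0 ≤ q := le_trans (by positivity) hq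
  have h₃ : 0 ≤ (p : ℝ) ^ 3 - p ^ 2 - p - 1 := by
    nlinarith [mul_nonneg (sub_nonneg.2 hpR) (sq_nonneg (p : ℝ)),
      mul_nonneg (sub_nonneg.2 hpR) (sub_nonneg.2 hpR)]
  have h₄ : 0 ≤ (p : ℝ) * (q * (1 + p + p ^ 2) - p ^ 2) := by
    have : (p : ℝ) ^ 2 ≤ q := by nlinarith [sq_nonneg (p : ℝ)]
    refine mul_nonneg (by linarith) ?_
    nlinarith [mul_nonneg hq₀ (show (0 : ℝ) ≤ p + p ^ 2 by positivity)]
  nlinarith [mul_nonneg h₃ (sq_nonneg q)]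

/-- The lower bound for matrices of even size, with the size of the probability space as a
parameter. -/
theorem bilinear_even_lower_bound {p : ℕ} [Fact p.Prime] {k e : ℕ} (hk : 3 ≤ k) (hke : k ≤ e)
    {κ : Type*} [Fintype κ]
    {μ η : κ → Matrix (Fin 2 × Fin e) (Fin 2 × Fin e) (ZMod p) →ₗ[ZMod p] ZMod p}
    {α : κ → Fin 2 × Fin e → Fin 2 × Fin e → ZMod p}
    (h : ∀ x y i j, (x * y) i j = ∑ k, α k i j * μ k x * η k y) {N q : ℝ} (hN : N = 2 * e)
    (hq : q = (p : ℝ) ^ k) :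
    3 * N ^ 2 * (q ^ 3 - p ^ 3 * q ^ 2) * p ^ 3 ≤
      2 * ((Fintype.card κ - N ^ 2) * (p ^ 3 - 1) * q ^ 3 + 3 * N * q ^ 6 * p ^ 3) := by
  classical
  have hμ (x : Matrix (Fin 2 × Fin e) (Fin 2 × Fin e) (ZMod p)) (hx : ∀ k, μ k x = 0) : x = 0 := by
    ext i j
    have := h x 1 i j
    simpa [hx] using this
  let s : Finset (Fin 3 → Fin k → ZMod p) := {v | LinearIndependent (ZMod p) v}
  have hs (v) : v ∈ s ↔ LinearIndependent (ZMod p) v := by simp [s]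
  obtain ⟨A₀, hA₀⟩ := exists_isUnit_koszul (p := p) (k := k) (e := e) (by omega) hke
  obtain ⟨J, S, A, hJ, hS, hJS, hA⟩ := exists_isUnit_koszul_of_forms hμ s
    ⟨A₀, fun v hv => hA₀ v ((hs v).1 hv)⟩
  let l (c : κ) : (Fin k → ZMod p) →ₗ[ZMod p] ZMod p := μ c ∘ₗ Fintype.linearCombination (ZMod p) A
  have hl (c : κ) (g : Fin k → ZMod p) : l c g = μ c (∑ i, g i • A i) := rfl
  let T (c : κ) : Finset (Fin 3 → Fin k → ZMod p) := {v | ¬ ∀ i, l c (v i) = 0}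
  have hp : (0 : ℝ) < p := by exact_mod_cast (Fact.out : p.Prime).pos
  have hp1 : (1 : ℝ) ≤ (p : ℝ) ^ 3 := by exact_mod_cast Nat.one_le_pow _ _ (Fact.out : p.Prime).pos
  have hq₀ : 0 < q := by rw [hq]; positivity
  have hcardV : (Fintype.card (Fin k → ZMod p) : ℝ) = q := by simp [hq]
  have hcardV3 : (#(univ : Finset (Fin 3 → Fin k → ZMod p)) : ℝ) = q ^ 3 := by
    rw [card_univ, Fintype.card_fun]
    push_cast
    rw [hcardV, Fintype.card_fin]
  have hs3 : (#s : ℝ) ≤ q ^ 3 := by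
    rw [← hcardV3]
    exact_mod_cast card_le_univ s
  have hT₁ (c : κ) : (#(T c) : ℝ) ≤ q ^ 3 := by
    rw [← hcardV3]
    exact_mod_cast card_le_univ (T c)
  have hT₂ (c : κ) : (p : ℝ) ^ 3 * #(T c) ≤ (p ^ 3 - 1) * q ^ 3 := by
    have h₁ := card_le_mul_card_triples_zero (l c)
    have h₂ := card_filter_add_card_filter_not (s := univ)
      (fun v : Fin 3 → Fin k → ZMod p => ∀ i, l c (v i) = 0)
    have h₁' : q ^ 3 ≤ (#{v : Fin 3 → Fin k → ZMod p | ∀ i, l c (v i) = 0} : ℝ) * p ^ 3 := by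
      rw [← hcardV]
      exact_mod_cast h₁
    have h₂' : (#{v : Fin 3 → Fin k → ZMod p | ∀ i, l c (v i) = 0} : ℝ) + #(T c) = q ^ 3 := by
      rw [← hcardV3]
      exact_mod_cast h₂
    linear_combination h₁' + (p : ℝ) ^ 3 * h₂'
  have hT₃ (c : κ) (hc : c ∈ J) (hcS : c ∉ S) : #(T c) = 0 := by
    rw [card_eq_zero, filter_eq_empty_iff]
    intro v _
    push Not
    intro i
    rw [hl, map_sum]
    exact sum_eq_zero fun j _ => by rw [map_smul, hJS c hc hcS, smul_zero]
  have hT (c : κ) : (p : ℝ) ^ 3 * #(T c) ≤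
      (if c ∈ Jᶜ then (p ^ 3 - 1) * q ^ 3 else 0) + (if c ∈ S then p ^ 3 * q ^ 3 else 0) := by
    by_cases hcJ : c ∈ J
    · by_cases hcS : c ∈ S
      · simp only [mem_compl, hcJ, not_true_eq_false, if_false, hcS, if_true, zero_add]
        exact mul_le_mul_of_nonneg_left (hT₁ c) (by positivity)
      · simp [hT₃ c hcJ hcS, hcJ, hcS]
    · have : (0 : ℝ) ≤ if c ∈ S then (p : ℝ) ^ 3 * q ^ 3 else 0 := by split_ifs <;> positivity
      simpa [hcJ] using (hT₂ c).trans (le_add_of_nonneg_right this)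
  have hsumT := sum_le_sum fun c (_ : c ∈ (univ : Finset κ)) => hT c
  rw [← mul_sum, sum_add_distrib, sum_ite_mem, sum_ite_mem, univ_inter, univ_inter, sum_const,
    sum_const, nsmul_eq_mul, nsmul_eq_mul] at hsumT
  have hcardι : (Fintype.card (Fin 2 × Fin e) : ℝ) = N := by simp [hN]
  have hJc : (#Jᶜ : ℝ) = Fintype.card κ - N ^ 2 := by
    rw [← hcardι, eq_sub_iff_add_eq]
    exact_mod_cast hJ ▸ card_compl_add_card J
  have hS' : (#S : ℝ) ≤ q ^ 3 * (3 * N) := by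
    refine le_trans (b := (#s : ℝ) * (3 * N)) ?_ ?_
    · rw [← hcardι]
      exact_mod_cast hS
    · exact mul_le_mul_of_nonneg_right hs3 (by rw [hN]; positivity)
  have hlow : #s * (3 * Fintype.card (Fin 2 × Fin e) ^ 2) ≤ 2 * ∑ c, #(T c) := by
    have h₁ (v : Fin 3 → Fin k → ZMod p) (hv : v ∈ s) : 3 * Fintype.card (Fin 2 × Fin e) ^ 2 ≤
        2 * #{c | ¬ ∀ i, l c (v i) = 0} := by
      refine three_mul_card_sq_le_of_isUnit_koszul h (hA v hv) _ fun c hc => ?_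
      simp only [mem_filter, mem_univ, true_and, not_not] at hc
      exact ⟨hc 0, hc 1, hc 2⟩
    have h₂ : ∑ c, #(T c) = ∑ v : Fin 3 → Fin k → ZMod p, #{c | ¬ ∀ i, l c (v i) = 0} := by
      simp only [T, card_filter]
      exact sum_comm
    rw [h₂, mul_sum, ← smul_eq_mul]
    refine (card_nsmul_le_sum s _ _ h₁).trans ?_
    exact sum_le_sum_of_subset (subset_univ s)
  have hlow' : (#s : ℝ) * (3 * N ^ 2) ≤ 2 * ∑ c, (#(T c) : ℝ) := by
    rw [← hcardι]
    exact_mod_cast hlow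
  have hsge := card_filter_linearIndependent_ge hk s hs
  rw [← hq] at hsge
  calc 3 * N ^ 2 * (q ^ 3 - p ^ 3 * q ^ 2) * p ^ 3
      = (q ^ 3 - p ^ 3 * q ^ 2) * (3 * N ^ 2) * p ^ 3 := by ring
    _ ≤ #s * (3 * N ^ 2) * p ^ 3 := by gcongr
    _ ≤ (2 * ∑ c, (#(T c) : ℝ)) * p ^ 3 := by gcongr
    _ = 2 * (p ^ 3 * ∑ c, (#(T c) : ℝ)) := by ring
    _ ≤ 2 * (#Jᶜ * ((p ^ 3 - 1) * q ^ 3) + #S * (p ^ 3 * q ^ 3)) := by gcongr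
    _ ≤ 2 * ((Fintype.card κ - N ^ 2) * ((p ^ 3 - 1) * q ^ 3) +
        q ^ 3 * (3 * N) * (p ^ 3 * q ^ 3)) := by
      rw [hJc]
      gcongr
    _ = _ := by ring

/-- A bilinear computation of a matrix product restricts to smaller matrices. -/
theorem bilinear_restrict {F ι ι' κ : Type*} [Field F] [Fintype ι] [Fintype ι'] [DecidableEq ι]
    [DecidableEq ι'] [Fintype κ] (f : ι ↪ ι') {μ η : κ → Matrix ι' ι' F →ₗ[F] F}
    {α : κ → ι' → ι' → F} (h : ∀ x y i j, (x * y) i j = ∑ k, α k i j * μ k x * η k y) :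
    ∃ (μ' η' : κ → Matrix ι ι F →ₗ[F] F) (α' : κ → ι → ι → F),
      ∀ x y i j, (x * y) i j = ∑ k, α' k i j * μ' k x * η' k y := by
  let P : Matrix ι' ι F := (1 : Matrix ι' ι' F).submatrix id f
  have hP : Pᵀ * P = 1 := by
    ext a b
    simp [P, mul_apply, one_apply, f.injective.eq_iff]
  let L : Matrix ι ι F →ₗ[F] Matrix ι' ι' F :=
    { toFun := fun x => P * x * Pᵀ
      map_add' := fun x y => by simp [Matrix.mul_add, Matrix.add_mul]
      map_smul' := fun c x => by simp }
  refine ⟨fun k => μ k ∘ₗ L, fun k => η k ∘ₗ L, fun k i j => α k (f i) (f j), fun x y i j => ?_⟩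
  have hL : L x * L y = P * (x * y) * Pᵀ := by
    change P * x * Pᵀ * (P * y * Pᵀ) = _
    calc P * x * Pᵀ * (P * y * Pᵀ) = P * x * (Pᵀ * P) * y * Pᵀ := by simp only [Matrix.mul_assoc]
      _ = _ := by rw [hP, Matrix.mul_one, Matrix.mul_assoc P x y]
  have hxy : x * y = (P * (x * y) * Pᵀ).submatrix f f := by
    have h₁ : Pᵀ * (P * (x * y) * Pᵀ) * P = x * y := by
      calc Pᵀ * (P * (x * y) * Pᵀ) * P = (Pᵀ * P) * (x * y) * (Pᵀ * P) := by
            simp only [Matrix.mul_assoc]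
        _ = x * y := by rw [hP, Matrix.one_mul, Matrix.mul_one]
    conv_lhs => rw [← h₁]
    ext a b
    simp [P, mul_apply, one_apply]
  rw [hxy, submatrix_apply, ← hL, h]
  rfl

end Matrix

/-- The final estimate, with `t` the fourth root of the size of the matrices. -/
theorem lower_bound_estimate {P q t N m : ℝ} (hP : 2 ≤ P) (ht : 1 ≤ t) (hq : 0 < q) (hqt : q ≤ t)
    (htq : t ≤ P * q) (hN₀ : t ^ 4 - 1 ≤ N) (hN₁ : N ≤ t ^ 4)
    (h : 3 * N ^ 2 * (q ^ 3 - P ^ 3 * q ^ 2) * P ^ 3 ≤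
      2 * ((m - N ^ 2) * (P ^ 3 - 1) * q ^ 3 + 3 * N * q ^ 6 * P ^ 3)) :
    (5 / 2 + 3 / (2 * (P ^ 3 - 1))) * t ^ 8 - (3 * P ^ 4 + 14) * t ^ 7 ≤ m := by
  have hP3 : (8 : ℝ) ≤ P ^ 3 := by nlinarith [pow_le_pow_left₀ (by norm_num) hP 3]
  set u := P ^ 3 - 1 with hu
  have hu7 : 7 ≤ u := by linarith
  have hu0 : 0 < u := by linarith
  set r := 1 + 1 / u with hr
  have hru : u * r = P ^ 3 := by rw [hr]; field_simp; linarith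
  have hr2 : r ≤ 2 := by
    have : 1 / u ≤ 1 := by rw [div_le_one hu0]; linarith
    linarith
  have hr1 : 0 ≤ r := by positivity
  have hc : 5 / 2 + 3 / (2 * u) = 1 + 3 / 2 * r := by rw [hr]; field_simp; ring
  have ht4 : 1 ≤ t ^ 4 := one_le_pow₀ ht
  have hN : 0 ≤ N := by linarith
  have hm : N ^ 2 + 3 / 2 * r * (N ^ 2 - N ^ 2 * P ^ 3 / q) - 3 * r * N * q ^ 3 ≤ m := by
    have h₁ : 0 ≤ (m - (N ^ 2 + 3 / 2 * r * (N ^ 2 - N ^ 2 * P ^ 3 / q) - 3 * r * N * q ^ 3)) *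
        (2 * u * q ^ 3) := by
      have h₂ : (m - (N ^ 2 + 3 / 2 * r * (N ^ 2 - N ^ 2 * P ^ 3 / q) - 3 * r * N * q ^ 3)) *
          (2 * u * q ^ 3) = 2 * ((m - N ^ 2) * u * q ^ 3 + 3 * N * q ^ 6 * (u * r)) -
            3 * N ^ 2 * (q ^ 3 - P ^ 3 * q ^ 2) * (u * r) := by
        field_simp
        ring
      rw [h₂, hru]
      linarith
    have := nonneg_of_mul_nonneg_left h₁ (by positivity)
    linarith
  have h₁ : N ^ 2 * P ^ 3 / q ≤ P ^ 4 * t ^ 7 := by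
    rw [div_le_iff₀ hq]
    have h₃ : N ^ 2 ≤ t ^ 8 := by
      calc N ^ 2 ≤ (t ^ 4) ^ 2 := by gcongr
        _ = t ^ 8 := by ring
    calc N ^ 2 * P ^ 3 ≤ t ^ 8 * P ^ 3 := by gcongr
      _ = t ^ 7 * P ^ 3 * t := by ring
      _ ≤ t ^ 7 * P ^ 3 * (P * q) := by gcongr
      _ = _ := by ring
  have h₂ : N * q ^ 3 ≤ t ^ 7 := by
    calc N * q ^ 3 ≤ t ^ 4 * t ^ 3 := by gcongr
      _ = t ^ 7 := by ring
  have h₃ : t ^ 8 - 2 * t ^ 7 ≤ N ^ 2 := by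
    have h₄ : t ^ 4 ≤ t ^ 7 := pow_le_pow_right₀ ht (by norm_num)
    nlinarith
  have hP4 : 0 ≤ P ^ 4 * t ^ 7 := by positivity
  have ht7 : 0 ≤ t ^ 7 := by positivity
  rw [hc]
  have e₁ : 3 / 2 * r * (N ^ 2 * P ^ 3 / q) ≤ 3 * (P ^ 4 * t ^ 7) := by
    calc 3 / 2 * r * (N ^ 2 * P ^ 3 / q) ≤ 3 / 2 * 2 * (P ^ 4 * t ^ 7) := by gcongr
      _ = _ := by ring
  have e₂ : 3 * r * (N * q ^ 3) ≤ 6 * t ^ 7 := by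
    calc 3 * r * (N * q ^ 3) ≤ 3 * 2 * t ^ 7 := by gcongr
      _ = _ := by ring
  have e₃ : (1 + 3 / 2 * r) * (t ^ 8 - 2 * t ^ 7) ≤ (1 + 3 / 2 * r) * N ^ 2 := by gcongr
  have e₄ : (1 + 3 / 2 * r) * (2 * t ^ 7) ≤ 8 * t ^ 7 := by nlinarith
  linarith

/-- For every prime p, every bilinear computation of n×n matrix
product over GF(p) has length m ≥ (5/2 + 3/(2(p³−1)))·n² − C·n^(7/4). -/
theorem bilinear_matrix_product_lower_bound_gfp (p : ℕ) [Fact p.Prime] :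
    ∃ C : ℝ, 0 < C ∧ ∀ n : ℕ, 1 ≤ n → ∀ m : ℕ,
      ∀ μ η : Fin m → (Matrix (Fin n) (Fin n) (ZMod p) →ₗ[ZMod p] ZMod p),
      ∀ α : Fin m → Fin n → Fin n → ZMod p,
      (∀ x y : Matrix (Fin n) (Fin n) (ZMod p), ∀ i j : Fin n,
        (x * y) i j = ∑ k : Fin m, α k i j * μ k x * η k y) →
      (m : ℝ) ≥ (5 / 2 + 3 / (2 * ((p : ℝ) ^ 3 - 1))) * (n : ℝ) ^ 2
        - C * (n : ℝ) ^ ((7 : ℝ) / 4) := by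
  have hp := (Fact.out : p.Prime)
  have hpR : (2 : ℝ) ≤ p := by exact_mod_cast hp.two_le
  refine ⟨3 * (p : ℝ) ^ 4 + 14, by positivity, fun n hn m μ η α h => ?_⟩
  have hnR : (1 : ℝ) ≤ n := by exact_mod_cast hn
  obtain ⟨t, ht, ht4, ht7⟩ : ∃ t : ℝ, 1 ≤ t ∧ t ^ 4 = n ∧ (n : ℝ) ^ ((7 : ℝ) / 4) = t ^ 7 := by
    refine ⟨(n : ℝ) ^ ((1 : ℝ) / 4), Real.one_le_rpow hnR (by norm_num), ?_, ?_⟩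
    · rw [← Real.rpow_natCast, ← Real.rpow_mul (by positivity)]
      norm_num
    · rw [← Real.rpow_natCast, ← Real.rpow_mul (by positivity)]
      norm_num
  have ht8 : (n : ℝ) ^ 2 = t ^ 8 := by rw [← ht4]; ring
  rw [ht7, ht8, ge_iff_le]
  rcases lt_or_ge n ((p ^ 4) ^ 3) with hlt | hge
  · have htp : t ≤ (p : ℝ) ^ 3 := by
      refine le_of_pow_le_pow_left₀ (n := 4) (by norm_num) (by positivity) ?_
      rw [ht4]
      calc (n : ℝ) ≤ ((p : ℝ) ^ 4) ^ 3 := by exact_mod_cast hlt.le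
        _ = _ := by ring
    have hP3 : (8 : ℝ) ≤ (p : ℝ) ^ 3 := by nlinarith [pow_le_pow_left₀ (by norm_num) hpR 3]
    have hc : 5 / 2 + 3 / (2 * ((p : ℝ) ^ 3 - 1)) ≤ 4 := by
      have : 3 / (2 * ((p : ℝ) ^ 3 - 1)) ≤ 1 := by
        rw [div_le_one (by linarith)]
        linarith
      linarith
    have hle : (5 / 2 + 3 / (2 * ((p : ℝ) ^ 3 - 1))) * t ^ 8 ≤ (3 * (p : ℝ) ^ 4 + 14) * t ^ 7 := by
      calc (5 / 2 + 3 / (2 * ((p : ℝ) ^ 3 - 1))) * t ^ 8 ≤ 4 * t ^ 8 := by gcongr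
        _ = 4 * t * t ^ 7 := by ring
        _ ≤ (3 * (p : ℝ) ^ 4 + 14) * t ^ 7 := by
          gcongr
          nlinarith
    have : (0 : ℝ) ≤ m := by positivity
    linarith
  · have hp4 : 1 < p ^ 4 := Nat.one_lt_pow (by norm_num) hp.one_lt
    let k := Nat.log (p ^ 4) n
    have hk₀ : 3 ≤ k := Nat.le_log_of_pow_le hp4 hge
    have hk₁ : (p ^ 4) ^ k ≤ n := Nat.pow_log_le_self _ (by omega)
    have hk₂ : n < (p ^ 4) ^ (k + 1) := Nat.lt_pow_succ_log_self hp4 n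
    have hke : k ≤ n / 2 := by
      have h₁ : k < p ^ k := Nat.lt_pow_self hp.one_lt
      have h₂ : (p ^ 4) ^ k = (p ^ k) ^ 4 := by rw [← pow_mul, ← pow_mul, mul_comm]
      have h₃ : 2 * p ^ k ≤ (p ^ k) ^ 4 := by
        have : 2 ≤ (p ^ k) ^ 3 := by
          calc 2 ≤ p ^ k := by omega
            _ ≤ (p ^ k) ^ 3 := Nat.le_self_pow (by norm_num) _
        calc 2 * p ^ k ≤ (p ^ k) ^ 3 * p ^ k := Nat.mul_le_mul_right _ this
          _ = _ := by ring
      omega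
    obtain ⟨f⟩ : Nonempty (Fin 2 × Fin (n / 2) ↪ Fin n) := by
      rw [Function.Embedding.nonempty_iff_card_le]
      simp only [Fintype.card_prod, Fintype.card_fin]
      omega
    obtain ⟨μ', η', α', h'⟩ := Matrix.bilinear_restrict f h
    have hmain := Matrix.bilinear_even_lower_bound hk₀ hke h' rfl rfl
    rw [Fintype.card_fin] at hmain
    have he₀ : n ≤ 2 * (n / 2) + 1 := by omega
    have he₁ : 2 * (n / 2) ≤ n := by omega
    refine lower_bound_estimate hpR ht (by positivity) ?_ ?_ ?_ ?_ hmain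
    · refine le_of_pow_le_pow_left₀ (n := 4) (by norm_num) (by positivity) ?_
      rw [ht4, ← pow_mul, mul_comm k, pow_mul]
      exact_mod_cast hk₁
    · refine le_of_pow_le_pow_left₀ (n := 4) (by norm_num) (by positivity) ?_
      rw [ht4, ← pow_succ', ← pow_mul, mul_comm (k + 1), pow_mul]
      exact_mod_cast hk₂.le
    · rw [ht4, sub_le_iff_le_add]
      exact_mod_cast he₀
    · rw [ht4]
      exact_mod_cast he₁
end

section
/- Let p be a prime, let n, k be positive integers with k ≤ p^n, and let μ_1,…,μ_{n²} be n² linearly independent linear forms on M_n(GF(p)). Then there exist k matrices a_1,…,a_k ∈ M_n(GF(p)) such that a_i − a_j is invertible for every i ≠ j, and there exists a subset S ⊆ {1,…,n²} with |S| ≥ n² − C(k,2)·n such that μ_i(a_j) = 0 for every i ∈ S and every j ∈ {1,…,k}. -/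
open Finset in
/-- A polynomial not vanishing at the all-ones point does not vanish at the indicator of some
set of at most `totalDegree` variables. -/
lemma MvPolynomial.exists_eval_indicator_ne_zero {σ R : Type*} [Fintype σ] [DecidableEq σ]
    [CommRing R] (P : MvPolynomial σ R) (hP : MvPolynomial.eval (fun _ => 1) P ≠ 0) :
    ∃ B : Finset σ, B.card ≤ P.totalDegree ∧
      MvPolynomial.eval (fun l => if l ∈ B then 1 else 0) P ≠ 0 := by
  by_contra! h
  let g : Finset σ → R := fun B => ∑ m ∈ P.support with m.support = B, P.coeff m
  have heval (A : Finset σ) :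
      MvPolynomial.eval (fun l => if l ∈ A then 1 else 0) P = ∑ B ∈ A.powerset, g B := by
    have hmon (m : σ →₀ ℕ) : (∏ i ∈ m.support, (if i ∈ A then (1 : R) else 0) ^ m i)
        = if m.support ⊆ A then 1 else 0 := by
      split_ifs with hm
      · exact prod_eq_one fun i hi => by simp [hm hi]
      · obtain ⟨i, hi, hiA⟩ := not_subset.mp hm
        refine prod_eq_zero hi ?_
        rw [if_neg hiA, zero_pow (Finsupp.mem_support_iff.mp hi)]
    simp only [MvPolynomial.eval_eq, hmon, mul_ite, mul_one, mul_zero, g]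
    rw [← sum_filter, ← sum_fiberwise_of_maps_to (t := A.powerset) (g := fun m => m.support)
      (by simp)]
    refine sum_congr rfl fun B hB => sum_congr ?_ fun _ _ => rfl
    ext m
    simp only [mem_filter]
    constructor
    · rintro ⟨⟨h1, -⟩, h3⟩
      exact ⟨h1, h3⟩
    · rintro ⟨h1, h3⟩
      exact ⟨⟨h1, h3 ▸ mem_powerset.mp hB⟩, h3⟩
  have hg (A : Finset σ) : g A = 0 := by
    induction A using Finset.strongInduction with
    | H A ih =>
      by_cases hA : A.card ≤ P.totalDegree
      · have h0 := h A hA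
        rw [heval, sum_eq_single_of_mem A (mem_powerset_self A)] at h0
        · exact h0
        · exact fun B hB hne => ih B ((mem_powerset.mp hB).ssubset_of_ne hne)
      · refine sum_eq_zero fun m hm => ?_
        obtain ⟨h1, h2⟩ := mem_filter.mp hm
        refine absurd ?_ hA
        rw [← h2]
        refine le_trans ?_ (MvPolynomial.le_totalDegree h1)
        rw [card_eq_sum_ones]
        exact sum_le_sum fun i hi => Nat.one_le_iff_ne_zero.mpr (Finsupp.mem_support_iff.mp hi)
  apply hP
  have := heval univ
  simpa [hg] using this

/-- The determinant of a matrix of polynomials of degree at most one has degree at most the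
size of the matrix. -/
lemma MvPolynomial.totalDegree_det_le {σ R n : Type*} [Fintype n] [DecidableEq n] [CommRing R]
    (A : Matrix n n (MvPolynomial σ R)) (hA : ∀ r s, (A r s).totalDegree ≤ 1) :
    A.det.totalDegree ≤ Fintype.card n := by
  rw [Matrix.det_apply']
  refine MvPolynomial.totalDegree_finsetSum_le fun τ _ => ?_
  refine (MvPolynomial.totalDegree_mul _ _).trans ?_
  have h1 : (((Equiv.Perm.sign τ : ℤˣ) : ℤ) : MvPolynomial σ R).totalDegree = 0 := by
    rw [← map_intCast (MvPolynomial.C (σ := σ) (R := R))]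
    exact MvPolynomial.totalDegree_C _
  rw [h1, zero_add]
  refine (MvPolynomial.totalDegree_finsetProd _ _).trans ?_
  refine (Finset.sum_le_sum fun i _ => hA (τ i) i).trans ?_
  simp

/-- Left multiplications in the field with `p ^ n` elements give `p ^ n` matrices whose pairwise
differences are invertible. -/
lemma Matrix.exists_pairwise_isUnit_sub (p : ℕ) [Fact p.Prime] (n k : ℕ) (hn : n ≠ 0)
    (hk : k ≤ p ^ n) :
    ∃ a : Fin k → Matrix (Fin n) (Fin n) (ZMod p), ∀ i j, i ≠ j → IsUnit (a i - a j) := by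
  have hcard : Fintype.card (Fin k) ≤ Nat.card (GaloisField p n) := by
    rw [GaloisField.card p n hn, Fintype.card_fin]
    exact hk
  have := Fintype.ofFinite (GaloisField p n)
  rw [Nat.card_eq_fintype_card] at hcard
  obtain ⟨e⟩ := Function.Embedding.nonempty_of_card_le hcard
  let b := Module.finBasisOfFinrankEq (ZMod p) (GaloisField p n) (GaloisField.finrank p hn)
  refine ⟨fun i => Algebra.leftMulMatrix b (e i), fun i j hij => ?_⟩
  rw [← map_sub]
  exact (IsUnit.mk0 _ (sub_ne_zero.mpr (e.injective.ne hij))).map (Algebra.leftMulMatrix b)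

/-- As many linearly independent linear forms as the dimension are the coordinates of a linear
equivalence. -/
lemma exists_linearEquiv_apply_eq_of_linearIndependent {K V ι : Type*} [Field K] [AddCommGroup V]
    [Module K V] [FiniteDimensional K V] [Fintype ι] (μ : ι → (V →ₗ[K] K))
    (hμ : LinearIndependent K μ) (hcard : Fintype.card ι = Module.finrank K V) :
    ∃ Φ : V ≃ₗ[K] (ι → K), ∀ v i, Φ v i = μ i v := by
  have hspan : Submodule.span K (Set.range μ) = ⊤ :=
    hμ.span_eq_top_of_card_eq_finrank' (hcard.trans Subspace.dual_finrank_eq.symm)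
  have hinj : Function.Injective (LinearMap.pi μ) := by
    refine (injective_iff_map_eq_zero _).mpr fun v hv => ?_
    refine (Module.forall_dual_apply_eq_zero_iff K v).mp fun f => ?_
    have hf : f ∈ Submodule.span K (Set.range μ) := hspan ▸ Submodule.mem_top
    induction hf using Submodule.span_induction with
    | mem x hx =>
      obtain ⟨i, rfl⟩ := hx
      exact congrFun hv i
    | zero => simp
    | add x y _ _ hx hy => simp [hx, hy]
    | smul c x _ hx => simp [hx]
  exact ⟨LinearEquiv.ofInjectiveOfFinrankEq _ hinj (by simp [hcard]), fun v i => rfl⟩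

/-- For k ≤ p^n and n² linearly independent linear forms on
M_n(GF(p)), there are k matrices with pairwise invertible differences on all of
which at least n² − C(k,2)·n of the forms vanish. -/
theorem exists_matrices_invertible_differences_with_vanishing_forms_gfp
    (p : ℕ) [Fact p.Prime] (n k : ℕ) (hn : 1 ≤ n) (hk : 1 ≤ k) (hk2 : k ≤ p ^ n)
    (μ : Fin (n ^ 2) → (Matrix (Fin n) (Fin n) (ZMod p) →ₗ[ZMod p] ZMod p))
    (hμ : LinearIndependent (ZMod p) μ) :
    ∃ a : Fin k → Matrix (Fin n) (Fin n) (ZMod p),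
      (∀ i j : Fin k, i ≠ j → IsUnit (a i - a j)) ∧
      ∃ S : Finset (Fin (n ^ 2)),
        (n : ℤ) ^ 2 - (k.choose 2 : ℤ) * (n : ℤ) ≤ (S.card : ℤ) ∧
        ∀ i ∈ S, ∀ j : Fin k, μ i (a j) = 0 := by
  obtain ⟨a, ha⟩ := Matrix.exists_pairwise_isUnit_sub p n k (by omega) hk2
  obtain ⟨Φ, hΦ⟩ := exists_linearEquiv_apply_eq_of_linearIndependent μ hμ
    (by simp [Module.finrank_matrix, sq])
  let D (y : Fin (n ^ 2) → ZMod p) (i : Fin k) : Matrix (Fin n) (Fin n) (ZMod p) :=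
    Φ.symm fun l => y l * Φ (a i) l
  let A (i j : Fin k) : Matrix (Fin n) (Fin n) (MvPolynomial (Fin (n ^ 2)) (ZMod p)) :=
    Matrix.of fun r s => ∑ l, MvPolynomial.C (Φ (a i - a j) l * Φ.symm (Pi.single l 1) r s) *
      MvPolynomial.X l
  let P : MvPolynomial (Fin (n ^ 2)) (ZMod p) := ∏ j, ∏ i ∈ Finset.Iio j, (A i j).det
  have hA (y : Fin (n ^ 2) → ZMod p) (i j : Fin k) :
      MvPolynomial.eval y (A i j).det = (D y i - D y j).det := by
    rw [RingHom.map_det]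
    congr 1
    have hD : D y i - D y j = ∑ l, (y l * Φ (a i - a j) l) • Φ.symm (Pi.single l 1) := by
      simp only [D, ← map_sub, ← map_smul, ← map_sum]
      congr 1
      ext l
      simp [Finset.sum_apply, Pi.single_apply, mul_sub]
    rw [hD]
    ext r s
    simp only [A, RingHom.mapMatrix_apply, Matrix.map_apply, Matrix.of_apply, map_sum, map_mul,
      MvPolynomial.eval_C, MvPolynomial.eval_X, Matrix.sum_apply, Matrix.smul_apply, smul_eq_mul]
    exact Finset.sum_congr rfl fun l _ => by ring
  have hdeg : P.totalDegree ≤ k.choose 2 * n := by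
    have hdet (i j : Fin k) : (A i j).det.totalDegree ≤ n := by
      refine (MvPolynomial.totalDegree_det_le _ fun r s => ?_).trans_eq (Fintype.card_fin n)
      simp only [A, Matrix.of_apply]
      refine MvPolynomial.totalDegree_finsetSum_le fun l _ => ?_
      refine (MvPolynomial.totalDegree_mul _ _).trans ?_
      rw [MvPolynomial.totalDegree_C, MvPolynomial.totalDegree_X]
    calc P.totalDegree ≤ ∑ j : Fin k, ∑ i ∈ Finset.Iio j, n :=
          (MvPolynomial.totalDegree_finsetProd _ _).trans <| Finset.sum_le_sum fun j _ =>
            (MvPolynomial.totalDegree_finsetProd _ _).trans <| Finset.sum_le_sum fun i _ =>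
              hdet i j
      _ = k.choose 2 * n := by
          simp only [Finset.sum_const, Fin.card_Iio, smul_eq_mul, ← Finset.sum_mul]
          rw [Fin.sum_univ_eq_sum_range (fun j => j), Finset.sum_range_id, Nat.choose_two_right]
  have hP : MvPolynomial.eval (fun _ => 1) P ≠ 0 := by
    simp only [P, map_prod, hA]
    refine Finset.prod_ne_zero_iff.mpr fun j _ => Finset.prod_ne_zero_iff.mpr fun i hi => ?_
    have hij := ha i j (Finset.mem_Iio.mp hi).ne
    rw [Matrix.isUnit_iff_isUnit_det] at hij
    simpa [D] using hij.ne_zero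
  obtain ⟨B, hB, hBP⟩ := MvPolynomial.exists_eval_indicator_ne_zero P hP
  simp only [P, map_prod, hA] at hBP
  have hlt (i j : Fin k) (hij : i < j) :
      IsUnit (D (fun l => if l ∈ B then 1 else 0) i - D (fun l => if l ∈ B then 1 else 0) j) := by
    rw [Matrix.isUnit_iff_isUnit_det]
    exact (Finset.prod_ne_zero_iff.mp (Finset.prod_ne_zero_iff.mp hBP j (Finset.mem_univ j)) i
      (Finset.mem_Iio.mpr hij)).isUnit
  refine ⟨D fun l => if l ∈ B then 1 else 0, fun i j hij => ?_, Bᶜ, ?_, fun i hi j => ?_⟩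
  · rcases hij.lt_or_gt with h | h
    · exact hlt i j h
    · rw [← neg_sub]
      exact (hlt j i h).neg
  · have hle : B.card ≤ n ^ 2 := by simpa using Finset.card_le_univ B
    rw [Finset.card_compl, Fintype.card_fin, Nat.cast_sub hle]
    have : (B.card : ℤ) ≤ k.choose 2 * n := mod_cast hB.trans hdeg
    push_cast
    linarith
  · rw [← hΦ]
    simp [D, Finset.mem_compl.mp hi]
end
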